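/- (Chatterjea-type fixed point theorem for multi-valued maps) Let (X, p) be a complete partial metric space and let T be a map assigning to each x ∈ X a nonempty, closed (in the partial metric topology), bounded subset Tx ⊆ X. Suppose there is a constant λ ∈ (0, 1/2) such that H_p(Tx, Ty) ≤ λ·(p(Tx, y) + p(Ty, x)) for all x, y ∈ X, where p(A, x) = inf{p(a, x) : a ∈ A}. Then T has a fixed point: there exists x ∈ X with x ∈ Tx. -/

import Mathlib

/-- The topology of a partial metric space, generated by the open balls
`B_p(x, ε) = {y : p x y < p x x + ε}`. -/
def pmTop {X : Type*} (p : X → X → ℝ) : TopologicalSpace X :=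
  TopologicalSpace.generateFrom
    {s : Set X | ∃ c : X, ∃ ε : ℝ, 0 < ε ∧ s = {y : X | p c y < p c c + ε}}

/-- `p(x, A) = inf {p(x, a) : a ∈ A}`. -/
noncomputable def pmDist {X : Type*} (p : X → X → ℝ) (x : X) (A : Set X) : ℝ :=
  sInf ((fun a => p x a) '' A)

/-- `p(A, x) = inf {p(a, x) : a ∈ A}`. -/
noncomputable def pmDistL {X : Type*} (p : X → X → ℝ) (A : Set X) (x : X) : ℝ :=
  sInf ((fun a => p a x) '' A)

/-- `δ_p(A, B) = sup {p(a, B) : a ∈ A}`. -/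
noncomputable def pmDelta {X : Type*} (p : X → X → ℝ) (A B : Set X) : ℝ :=
  sSup ((fun a => pmDist p a B) '' A)

/-- `H_p(A, B) = max {δ_p(A, B), δ_p(B, A)}`. -/
noncomputable def pmH {X : Type*} (p : X → X → ℝ) (A B : Set X) : ℝ :=
  max (pmDelta p A B) (pmDelta p B A)

/-- A subset `A` is bounded if there are `x₀ ∈ X` and `M ≥ 0` with `p x₀ a ≤ M` for all
`a ∈ A`. -/
def pmBounded {X : Type*} (p : X → X → ℝ) (A : Set X) : Prop :=
  ∃ x₀ : X, ∃ M : ℝ, 0 ≤ M ∧ ∀ a ∈ A, p x₀ a ≤ M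

/-- A sequence is Cauchy in a partial metric space if `p (x n) (x m)` converges to some
real number as `n, m → ∞`. -/
def pmCauchy {X : Type*} (p : X → X → ℝ) (x : ℕ → X) : Prop :=
  ∃ a : ℝ, Filter.Tendsto (fun q : ℕ × ℕ => p (x q.1) (x q.2))
    (Filter.atTop ×ˢ Filter.atTop) (nhds a)

/-- A sequence converges to `l` in a partial metric space if
`lim p (x n) l = lim p (x n) (x n) = p l l`. -/
def pmConvergesTo {X : Type*} (p : X → X → ℝ) (x : ℕ → X) (l : X) : Prop :=
  Filter.Tendsto (fun n => p (x n) l) Filter.atTop (nhds (p l l)) ∧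
  Filter.Tendsto (fun n => p (x n) (x n)) Filter.atTop (nhds (p l l))

/-- A partial metric space is complete if every Cauchy sequence converges. -/
def pmComplete {X : Type*} (p : X → X → ℝ) : Prop :=
  ∀ x : ℕ → X, pmCauchy p x → ∃ l : X, pmConvergesTo p x l

/-- Every open set of `pmTop p` contains a ball centred at each of its points. -/
theorem exists_ball_subset_of_isOpen_pmTop {X : Type*} {p : X → X → ℝ}
    (hp4 : ∀ x y z : X, p x y ≤ p x z + p z y - p z z) {s : Set X}
    (hs : @IsOpen X (pmTop p) s) {x : X} (hx : x ∈ s) :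
    ∃ ε : ℝ, 0 < ε ∧ {y : X | p x y < p x x + ε} ⊆ s := by
  change TopologicalSpace.GenerateOpen _ s at hs
  induction hs with
  | basic s hs =>
    obtain ⟨c, ε, -, rfl⟩ := hs
    refine ⟨p c c + ε - p c x, sub_pos.2 hx, fun y hy => ?_⟩
    have h := hp4 c y x
    simp only [Set.mem_ofPred_eq] at hy ⊢
    linarith
  | univ => exact ⟨1, one_pos, Set.subset_univ _⟩
  | inter s t _ _ ihs iht =>
    obtain ⟨ε, hε, hεs⟩ := ihs hx.1
    obtain ⟨δ, hδ, hδt⟩ := iht hx.2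
    refine ⟨min ε δ, lt_min hε hδ, fun y hy => ?_⟩
    simp only [Set.mem_ofPred_eq] at hy
    exact ⟨hεs (hy.trans_le (by gcongr; exact min_le_left _ _)),
      hδt (hy.trans_le (by gcongr; exact min_le_right _ _))⟩
  | sUnion S _ ih =>
    obtain ⟨t, htS, hxt⟩ := hx
    obtain ⟨ε, hε, h⟩ := ih t htS hxt
    exact ⟨ε, hε, h.trans (Set.subset_sUnion_of_mem htS)⟩

theorem pmDist_le {X : Type*} {p : X → X → ℝ} (hp : ∀ x y : X, 0 ≤ p x y) (x : X)
    {A : Set X} {a : X} (ha : a ∈ A) : pmDist p x A ≤ p x a :=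
  csInf_le ⟨0, by rintro _ ⟨b, -, rfl⟩; exact hp x b⟩ ⟨a, ha, rfl⟩

theorem exists_lt_of_pmDist_lt {X : Type*} {p : X → X → ℝ} {x : X} {A : Set X}
    (hA : A.Nonempty) {r : ℝ} (h : pmDist p x A < r) : ∃ a ∈ A, p x a < r := by
  obtain ⟨_, ⟨a, ha, rfl⟩, hr⟩ := exists_lt_of_csInf_lt (hA.image _) h
  exact ⟨a, ha, hr⟩

theorem pmDistL_eq_pmDist {X : Type*} {p : X → X → ℝ} (hp3 : ∀ x y : X, p x y = p y x)
    (A : Set X) (x : X) : pmDistL p A x = pmDist p x A := by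
  simp only [pmDistL, pmDist, hp3 _ x]

theorem pmDist_le_add_pmDist {X : Type*} {p : X → X → ℝ} (hp : ∀ x y : X, 0 ≤ p x y)
    (hp4 : ∀ x y z : X, p x y ≤ p x z + p z y - p z z) (x y : X) {A : Set X}
    (hA : A.Nonempty) : pmDist p x A ≤ p x y + pmDist p y A - p y y := by
  have h : pmDist p x A - p x y + p y y ≤ pmDist p y A := by
    refine le_csInf (hA.image _) ?_
    rintro _ ⟨a, ha, rfl⟩
    have h₁ := pmDist_le hp x ha
    have h₂ := hp4 x a y
    dsimp only
    linarith
  linarith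

/-- A point whose distance to a closed set equals its self-distance lies in that set. -/
theorem mem_of_isClosed_of_pmDist_le {X : Type*} {p : X → X → ℝ}
    (hp4 : ∀ x y z : X, p x y ≤ p x z + p z y - p z z) {A : Set X} (hA : A.Nonempty)
    (hc : @IsClosed X (pmTop p) A) {x : X} (hx : pmDist p x A ≤ p x x) : x ∈ A := by
  by_contra hxA
  obtain ⟨ε, hε, hs⟩ := exists_ball_subset_of_isOpen_pmTop hp4 hc.1 hxA
  obtain ⟨a, ha, hlt⟩ := exists_lt_of_pmDist_lt hA (hx.trans_lt (lt_add_of_pos_right _ hε))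
  exact hs hlt ha

theorem pmDist_le_pmH {X : Type*} {p : X → X → ℝ} (hp : ∀ x y : X, 0 ≤ p x y)
    (hp4 : ∀ x y z : X, p x y ≤ p x z + p z y - p z z)
    (hp3 : ∀ x y : X, p x y = p y x) {A B : Set X}
    (hA : pmBounded p A) (hB : B.Nonempty) {a : X} (ha : a ∈ A) :
    pmDist p a B ≤ pmH p A B := by
  suffices h : BddAbove ((fun a => pmDist p a B) '' A) from
    (le_csSup h ⟨a, ha, rfl⟩).trans (le_max_left _ _)
  obtain ⟨x₀, M, -, hM⟩ := hA
  obtain ⟨b, hb⟩ := hB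
  refine ⟨M + p x₀ b, ?_⟩
  rintro _ ⟨c, hc, rfl⟩
  have h₁ := pmDist_le hp c hb
  have h₂ := hp4 c b x₀
  have h₃ := hM c hc
  have h₄ := hp x₀ x₀
  rw [hp3 c x₀] at h₂
  dsimp only
  linarith

/-- A sequence whose consecutive distances decay geometrically is dominated by a geometric
sequence. -/
theorem pm_le_geometric {X : Type*} {p : X → X → ℝ}
    (hp1 : ∀ x y : X, 0 ≤ p x x ∧ p x x ≤ p x y)
    (hp4 : ∀ x y z : X, p x y ≤ p x z + p z y - p z z) {u : ℕ → X} {D k : ℝ}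
    (hD : 0 ≤ D) (hk : 0 ≤ k) (hu : ∀ n, p (u n) (u (n + 1)) ≤ D * (1 - k) * k ^ n)
    (j n : ℕ) : p (u n) (u (n + j)) ≤ D * k ^ n := by
  induction j generalizing n with
  | zero =>
    have h₁ := (hp1 (u n) (u (n + 1))).2
    have h₂ := hu n
    have h₃ : 0 ≤ D * k * k ^ n := by positivity
    rw [add_zero]
    linarith
  | succ j ih =>
    have h₁ := hu n
    have h₂ := ih (n + 1)
    have h₃ := hp4 (u n) (u (n + 1 + j)) (u (n + 1))
    have h₄ := (hp1 (u (n + 1)) (u (n + 1))).1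
    rw [pow_succ] at h₂
    rw [show n + (j + 1) = n + 1 + j by omega]
    linarith

theorem pm_tendsto_zero_of_geometric {X : Type*} {p : X → X → ℝ}
    (hp1 : ∀ x y : X, 0 ≤ p x x ∧ p x x ≤ p x y) (hp3 : ∀ x y : X, p x y = p y x)
    (hp4 : ∀ x y z : X, p x y ≤ p x z + p z y - p z z) {u : ℕ → X} {D k : ℝ}
    (hD : 0 ≤ D) (hk : 0 ≤ k) (hk1 : k < 1)
    (hu : ∀ n, p (u n) (u (n + 1)) ≤ D * (1 - k) * k ^ n) :
    Filter.Tendsto (fun q : ℕ × ℕ => p (u q.1) (u q.2))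
      (Filter.atTop ×ˢ Filter.atTop) (nhds 0) := by
  have hgeo : Filter.Tendsto (fun n : ℕ => D * k ^ n) Filter.atTop (nhds 0) := by
    simpa using (tendsto_pow_atTop_nhds_zero_of_lt_one hk hk1).const_mul D
  have hsum : Filter.Tendsto (fun q : ℕ × ℕ => D * k ^ q.1 + D * k ^ q.2)
      (Filter.atTop ×ˢ Filter.atTop) (nhds 0) := by
    simpa using (hgeo.comp Filter.tendsto_fst).add (hgeo.comp Filter.tendsto_snd)
  refine squeeze_zero (fun q => (hp1 (u q.1) (u q.2)).1.trans (hp1 _ _).2) (fun q => ?_) hsum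
  have h₁ : 0 ≤ D * k ^ q.1 := by positivity
  have h₂ : 0 ≤ D * k ^ q.2 := by positivity
  rcases le_total q.1 q.2 with h | h
  · obtain ⟨j, hj⟩ := Nat.exists_eq_add_of_le h
    have := pm_le_geometric hp1 hp4 hD hk hu j q.1
    rw [← hj] at this
    linarith
  · obtain ⟨j, hj⟩ := Nat.exists_eq_add_of_le h
    have := pm_le_geometric hp1 hp4 hD hk hu j q.2
    rw [← hj, hp3] at this
    linarith


/-- Chatterjea-type fixed point theorem for multi-valued maps. -/
theorem chatterjea_multivalued_fixed_point
    {X : Type*} [Nonempty X] (p : X → X → ℝ)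
    (hp1 : ∀ x y : X, 0 ≤ p x x ∧ p x x ≤ p x y)
    (hp2 : ∀ x y : X, x = y ↔ (p x x = p x y ∧ p x y = p y y))
    (hp3 : ∀ x y : X, p x y = p y x)
    (hp4 : ∀ x y z : X, p x y ≤ p x z + p z y - p z z)
    (hcomplete : pmComplete p)
    (T : X → Set X)
    (hT : ∀ x : X, (T x).Nonempty ∧ @IsClosed X (pmTop p) (T x) ∧ pmBounded p (T x))
    (l : ℝ) (hl0 : 0 < l) (hl : l < 1 / 2)
    (hcontr : ∀ x y : X,
      pmH p (T x) (T y) ≤ l * (pmDistL p (T x) y + pmDistL p (T y) x)) :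
    ∃ x : X, x ∈ T x := by
  have hp : ∀ x y : X, 0 ≤ p x y := fun x y => (hp1 x y).1.trans (hp1 x y).2
  have hdist : ∀ x y z : X, z ∈ T x →
      pmDist p z (T y) ≤ l * (pmDist p y (T x) + pmDist p x (T y)) := fun x y z hz => by
    have h := hcontr x y
    rw [pmDistL_eq_pmDist hp3, pmDistL_eq_pmDist hp3] at h
    exact (pmDist_le_pmH hp hp4 hp3 (hT x).2.2 (hT y).1 hz).trans h
  by_contra! hno
  have hpos : ∀ x y : X, y ∈ T x → 0 < p x y := fun x y hy => by
    refine lt_of_le_of_ne (hp x y) fun h0 => ?_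
    have hxy : x = y := by
      have h₁ := hp1 x y
      have h₂ := hp1 y x
      rw [hp3 y x] at h₂
      exact (hp2 x y).2 ⟨by linarith, by linarith⟩
    exact hno x (hxy ▸ hy)
  obtain ⟨k, hlk, hk1⟩ : ∃ k, l / (1 - l) < k ∧ k < 1 :=
    exists_between ((div_lt_one (by linarith)).2 (by linarith))
  have hk0 : 0 < k := (div_pos hl0 (by linarith)).trans hlk
  have hstep : ∀ x y : X, y ∈ T x → ∃ z ∈ T y, p y z < k * p x y := fun x y hy => by
    refine exists_lt_of_pmDist_lt (hT y).1 ?_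
    have h₁ := hdist x y y hy
    have h₂ := pmDist_le hp y hy
    have h₃ := pmDist_le_add_pmDist hp hp4 x y (hT y).1
    have h₄ : pmDist p y (T y) ≤ l * (p x y + pmDist p y (T y)) :=
      h₁.trans (mul_le_mul_of_nonneg_left (by linarith) hl0.le)
    have h₅ : pmDist p y (T y) ≤ l / (1 - l) * p x y := by
      rw [div_mul_eq_mul_div, le_div_iff₀ (by linarith)]
      linarith
    exact h₅.trans_lt (mul_lt_mul_of_pos_right hlk (hpos x y hy))
  choose! f hfT hfk using hstep
  obtain ⟨x₀⟩ := ‹Nonempty X›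
  obtain ⟨x₁, hx₁⟩ := (hT x₀).1
  let v : ℕ → X × X := fun n => (fun q : X × X => (q.2, f q.1 q.2))^[n] (x₀, x₁)
  have hv : ∀ n, v (n + 1) = ((v n).2, f (v n).1 (v n).2) := fun n =>
    Function.iterate_succ_apply' _ _ _
  have hvT : ∀ n, (v n).2 ∈ T (v n).1 := fun n => by
    induction n with
    | zero => exact hx₁
    | succ n ih => rw [hv]; exact hfT _ _ ih
  set D : ℝ := p x₀ x₁ / (1 - k) with hD
  have hD0 : 0 ≤ D := div_nonneg (hp _ _) (by linarith)
  have hvk : ∀ n, p (v n).1 (v n).2 ≤ D * (1 - k) * k ^ n := fun n => by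
    induction n with
    | zero =>
      rw [hD, div_mul_cancel₀ _ (by linarith), pow_zero, mul_one]
      exact le_rfl
    | succ n ih =>
      rw [hv, pow_succ]
      have h₁ := hfk _ _ (hvT n)
      have h₂ := mul_le_mul_of_nonneg_left ih hk0.le
      dsimp only
      linarith
  let u : ℕ → X := fun n => (v n).1
  have hu : ∀ n, u (n + 1) = (v n).2 := fun n => by simp only [u, hv]
  have huT : ∀ n, u (n + 1) ∈ T (u n) := fun n => by rw [hu]; exact hvT n
  have hlim := pm_tendsto_zero_of_geometric (u := u) hp1 hp3 hp4 hD0 hk0.le hk1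
    fun n => by rw [hu]; exact hvk n
  obtain ⟨x, hx, hxx⟩ := hcomplete u ⟨0, hlim⟩
  have hx0 : p x x = 0 := tendsto_nhds_unique hxx
    (hlim.comp (Filter.tendsto_id.prodMk Filter.tendsto_id))
  rw [hx0] at hx
  have hbound : ∀ n, (1 - l) * pmDist p x (T x) ≤
      p (u (n + 1)) x + l * (p (u (n + 1)) x + p (u n) x) := fun n => by
    have h₁ := hdist (u n) x (u (n + 1)) (huT n)
    have h₂ := pmDist_le hp x (huT n)
    have h₃ := pmDist_le_add_pmDist hp hp4 (u n) x (hT x).1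
    have h₄ := pmDist_le_add_pmDist hp hp4 x (u (n + 1)) (hT x).1
    have h₅ := hp (u (n + 1)) (u (n + 1))
    rw [hp3 x] at h₂ h₄
    have h₆ := h₁.trans (mul_le_mul_of_nonneg_left
      (show _ ≤ p (u (n + 1)) x + (p (u n) x + pmDist p x (T x)) by linarith) hl0.le)
    linarith
  have hx' := hx.comp (Filter.tendsto_add_atTop_nat 1)
  have hle : (1 - l) * pmDist p x (T x) ≤ 0 := by
    have h := hx'.add ((hx'.add hx).const_mul l)
    rw [add_zero, mul_zero, add_zero] at h
    exact ge_of_tendsto' h hbound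
  refine hno x (mem_of_isClosed_of_pmDist_le hp4 (hT x).1 (hT x).2.1 ?_)
  rw [hx0]
  exact nonpos_of_mul_nonpos_right hle (by linarith)
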